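/- Let n ≥ 1, r > 0, R > 0, and let E ⊆ ℝⁿ be a measurable set with |E| = |B_R|. Then Per_r(E) ≥ Per_r(B_R). -/

import Mathlib

open MeasureTheory Metric Set Filter Bornology
open scoped ENNReal NNReal Pointwise

noncomputable section

/-- The set of points of Lebesgue density one of `E ⊆ ℝⁿ`. -/
def densityOnePoints (n : ℕ) (E : Set (EuclideanSpace ℝ (Fin n))) :
    Set (EuclideanSpace ℝ (Fin n)) :=
  {x | Tendsto (fun ρ : ℝ => volume (E ∩ ball x ρ) / volume (ball x ρ))
        (nhdsWithin 0 (Ioi 0)) (nhds 1)}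

/-- Minkowski sum `A ⊕ B_r = ⋃_{x ∈ A} B_r(x)`. -/
def minkSum (n : ℕ) (r : ℝ) (A : Set (EuclideanSpace ℝ (Fin n))) :
    Set (EuclideanSpace ℝ (Fin n)) :=
  ⋃ x ∈ A, ball x r

/-- The nonlocal Minkowski perimeter `Per_r(E) = (1/(2r)) |(∂E) ⊕ B_r|`, where `∂E`
is the topological boundary of the density-one representative of `E`. -/
def perR (n : ℕ) (r : ℝ) (E : Set (EuclideanSpace ℝ (Fin n))) : ℝ≥0∞ :=
  volume (minkSum n r (frontier (densityOnePoints n E))) / ENNReal.ofReal (2 * r)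

/-- The inner set `E ⊖ B_r = E \ ((∂E) ⊕ B_r)` (for the density-one representative). -/
def minkSub (n : ℕ) (r : ℝ) (E : Set (EuclideanSpace ℝ (Fin n))) :
    Set (EuclideanSpace ℝ (Fin n)) :=
  densityOnePoints n E \ minkSum n r (frontier (densityOnePoints n E))

/-- The Riesz energy `Φ_α(E) = ∫_E ∫_E |x-y|^{-α} dx dy`. -/
def rieszEnergy (n : ℕ) (α : ℝ) (E : Set (EuclideanSpace ℝ (Fin n))) : ℝ≥0∞ :=
  ∫⁻ x in E, ∫⁻ y in E, edist x y ^ (-α)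

/-- The radius of the ball in `ℝⁿ` with unit volume. -/
def unitRadius (n : ℕ) : ℝ :=
  (volume (ball (0 : EuclideanSpace ℝ (Fin n)) 1)).toReal ^ (-(n : ℝ)⁻¹)

/-- A rigid motion of `ℝⁿ`: a rotation followed by a translation. -/
def IsRigidMotion (n : ℕ) (g : EuclideanSpace ℝ (Fin n) → EuclideanSpace ℝ (Fin n)) : Prop :=
  ∃ (R : EuclideanSpace ℝ (Fin n) ≃ₗᵢ[ℝ] EuclideanSpace ℝ (Fin n))
    (v : EuclideanSpace ℝ (Fin n)),
    LinearMap.det (R.toLinearEquiv : EuclideanSpace ℝ (Fin n) →ₗ[ℝ] EuclideanSpace ℝ (Fin n)) = 1 ∧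
    ∀ x, g x = R x + v

/-- One-dimensional Brunn-Minkowski inequality, compact case. -/
lemma bm1_compact {A B C : Set ℝ} (hA : IsCompact A) (hB : IsCompact B) (hA0 : A.Nonempty)
    (hB0 : B.Nonempty) (hC : ∀ x ∈ A, ∀ y ∈ B, x + y ∈ C) :
    volume A + volume B ≤ volume C := by
  have ha := hA.sSup_mem hA0
  have hb := hB.sInf_mem hB0
  set a := sSup A with ha'
  set b := sInf B with hb'
  have h1 : (fun x => x + b) '' A ⊆ C := by
    rintro _ ⟨x, hx, rfl⟩; exact hC x hx b hb
  have h2 : (fun x => a + x) '' B ⊆ C := by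
    rintro _ ⟨x, hx, rfl⟩; exact hC a ha x hx
  have m1 : volume ((fun x => x + b) '' A) = volume A := by
    rw [image_add_right]; exact measure_preimage_add_right _ _ _
  have m2 : volume ((fun x => a + x) '' B) = volume B := by
    rw [image_add_left]; exact measure_preimage_add _ _ _
  have hd : AEDisjoint volume ((fun x => x + b) '' A) ((fun x => a + x) '' B) := by
    refine measure_mono_null (t := {a + b}) ?_ (by simp)
    rintro z ⟨⟨x, hx, rfl⟩, ⟨y, hy, hxy⟩⟩
    have h3 : x ≤ a := le_csSup hA.bddAbove hx
    have h4 : b ≤ y := csInf_le hB.bddBelow hy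
    simp only [mem_singleton_iff] at *
    linarith
  have hm : NullMeasurableSet ((fun x => a + x) '' B) volume :=
    (hB.image (by fun_prop)).measurableSet.nullMeasurableSet
  rw [← m1, ← m2, ← measure_union₀ hm hd]
  exact measure_mono (union_subset h1 h2)

lemma bm1 {A B C : Set ℝ} (hA : MeasurableSet A) (hB : MeasurableSet B) (hA0 : A.Nonempty)
    (hB0 : B.Nonempty) (hC : ∀ x ∈ A, ∀ y ∈ B, x + y ∈ C) :
    volume A + volume B ≤ volume C := by
  obtain ⟨a, ha⟩ := hA0
  obtain ⟨b, hb⟩ := hB0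
  have key : ∀ K ⊆ A, IsCompact K → ∀ L ⊆ B, IsCompact L → volume K + volume L ≤ volume C := by
    intro K hK hKc L hL hLc
    refine le_trans (add_le_add (measure_mono (subset_insert a K))
      (measure_mono (subset_insert b L))) ?_
    refine bm1_compact (hKc.insert a) (hLc.insert b) (insert_nonempty _ _) (insert_nonempty _ _) ?_
    intro x hx y hy
    exact hC x (insert_subset ha hK hx) y (insert_subset hb hL hy)
  have hsup : ∀ A : Set ℝ, MeasurableSet A →
      volume A = ⨆ K : {K : Set ℝ // K ⊆ A ∧ IsCompact K}, volume K.1 := by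
    intro A hA
    rw [hA.measure_eq_iSup_isCompact]
    simp only [iSup_subtype, iSup_and]
  have : ∀ A : Set ℝ, Nonempty {K : Set ℝ // K ⊆ A ∧ IsCompact K} :=
    fun A => ⟨⟨∅, empty_subset _, isCompact_empty⟩⟩
  rw [hsup A hA, hsup B hB]
  exact ENNReal.iSup_add_iSup_le fun K L => key K.1 K.2.1 K.2.2 L.1 L.2.1 L.2.2

lemma amgm {a b : ℝ} (ha : 0 < a) (hb : 0 < b) (hab : a + b = 1) (x y : ℝ≥0∞) :
    x ^ a * y ^ b ≤ ENNReal.ofReal a * x + ENNReal.ofReal b * y := by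
  have hpq : (a⁻¹).HolderConjugate b⁻¹ := by
    rw [Real.holderConjugate_iff]
    constructor
    · exact (one_lt_inv₀ ha).2 (by linarith)
    · simpa using hab
  have := ENNReal.young_inequality (x ^ a) (y ^ b) hpq
  rw [← ENNReal.rpow_mul, ← ENNReal.rpow_mul, mul_inv_cancel₀ ha.ne', mul_inv_cancel₀ hb.ne',
    ENNReal.rpow_one, ENNReal.rpow_one, ENNReal.ofReal_inv_of_pos ha, ENNReal.ofReal_inv_of_pos hb,
    div_eq_mul_inv, div_eq_mul_inv, inv_inv, inv_inv, mul_comm x, mul_comm y] at this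
  exact this

lemma layer {f : ℝ → ℝ≥0∞} (hf : Measurable f) (h1 : ∀ x, f x ≤ 1) :
    ∫⁻ x, f x = ∫⁻ t in Ioi (0:ℝ), volume {x | ENNReal.ofReal t < f x} := by
  have := lintegral_eq_lintegral_meas_lt (f := fun x => (f x).toReal) volume
    (Eventually.of_forall fun x => ENNReal.toReal_nonneg) hf.ennreal_toReal.aemeasurable
  have hfin : ∀ x, f x ≠ ⊤ := fun x => ((h1 x).trans_lt ENNReal.one_lt_top).ne
  simp only [ENNReal.ofReal_toReal (hfin _)] at this
  rw [this]
  refine setLIntegral_congr_fun measurableSet_Ioi fun t ht => ?_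
  congr 1
  ext x
  exact (ENNReal.ofReal_lt_iff_lt_toReal (le_of_lt ht) (hfin x)).symm

lemma pl1_norm {a b : ℝ} (ha : 0 < a) (hb : 0 < b) (hab : a + b = 1) {f g h : ℝ → ℝ≥0∞}
    (hf : Measurable f) (hg : Measurable g) (hh : Measurable h)
    (hf1 : ⨆ x, f x = 1) (hg1 : ⨆ x, g x = 1)
    (H : ∀ x y, f x ^ a * g y ^ b ≤ h (a * x + b * y)) :
    (∫⁻ x, f x) ^ a * (∫⁻ x, g x) ^ b ≤ ∫⁻ x, h x := by
  have hfl : ∀ x, f x ≤ 1 := fun x => hf1 ▸ le_iSup f x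
  have hgl : ∀ x, g x ≤ 1 := fun x => hg1 ▸ le_iSup g x
  refine (amgm ha hb hab _ _).trans ?_
  refine le_trans ?_ (lintegral_mono (f := fun x => min (h x) 1) fun x => min_le_left _ _)
  rw [layer hf hfl, layer hg hgl, layer (hh.min measurable_const) (fun x => min_le_right _ _),
    ← lintegral_const_mul' _ _ ENNReal.ofReal_ne_top,
    ← lintegral_const_mul' _ _ ENNReal.ofReal_ne_top, ← lintegral_add_left]
  swap
  · refine Measurable.const_mul (Antitone.measurable fun s t hst => measure_mono fun x hx => ?_) _
    exact lt_of_le_of_lt (ENNReal.ofReal_le_ofReal hst) hx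
  refine lintegral_mono fun t => ?_
  by_cases ht : ENNReal.ofReal t < 1
  · have hA : {x | ENNReal.ofReal t < f x}.Nonempty := by
      obtain ⟨x, hx⟩ := lt_iSup_iff.1 (hf1.symm ▸ ht : ENNReal.ofReal t < ⨆ x, f x)
      exact ⟨x, hx⟩
    have hB : {x | ENNReal.ofReal t < g x}.Nonempty := by
      obtain ⟨x, hx⟩ := lt_iSup_iff.1 (hg1.symm ▸ ht : ENNReal.ofReal t < ⨆ x, g x)
      exact ⟨x, hx⟩
    have := bm1 (A := a • {x | ENNReal.ofReal t < f x}) (B := b • {x | ENNReal.ofReal t < g x})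
      (C := {x | ENNReal.ofReal t < min (h x) 1})
      ((measurableSet_lt measurable_const hf).const_smul₀ a)
      ((measurableSet_lt measurable_const hg).const_smul₀ b)
      hA.smul_set hB.smul_set ?_
    · simpa [Measure.addHaar_smul, abs_of_pos ha, abs_of_pos hb] using this
    · rintro _ ⟨x, hx, rfl⟩ _ ⟨y, hy, rfl⟩
      refine lt_min (lt_of_lt_of_le ?_ (H x y)) ht
      have e : ENNReal.ofReal t = ENNReal.ofReal t ^ a * ENNReal.ofReal t ^ b := by
        rw [← ENNReal.rpow_add_of_nonneg _ _ ha.le hb.le, hab, ENNReal.rpow_one]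
      rw [e]
      exact ENNReal.mul_lt_mul (ENNReal.rpow_lt_rpow hx ha) (ENNReal.rpow_lt_rpow hy hb)
  · have h1 : {x | ENNReal.ofReal t < f x} = ∅ := by
      ext x; simpa using (hfl x).trans (not_lt.1 ht)
    have h2 : {x | ENNReal.ofReal t < g x} = ∅ := by
      ext x; simpa using (hgl x).trans (not_lt.1 ht)
    simp [h1, h2]

lemma pl1_fin {a b : ℝ} (ha : 0 < a) (hb : 0 < b) (hab : a + b = 1) {f g h : ℝ → ℝ≥0∞}
    (hf : Measurable f) (hg : Measurable g) (hh : Measurable h)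
    (hf1 : ⨆ x, f x ≠ ⊤) (hg1 : ⨆ x, g x ≠ ⊤)
    (H : ∀ x y, f x ^ a * g y ^ b ≤ h (a * x + b * y)) :
    (∫⁻ x, f x) ^ a * (∫⁻ x, g x) ^ b ≤ ∫⁻ x, h x := by
  set S := ⨆ x, f x with hS
  set T := ⨆ x, g x with hT
  by_cases hS0 : S = 0
  · have : ∀ x, f x = 0 := fun x => le_antisymm (hS0 ▸ le_iSup f x) zero_le
    simp [this, ha]
  by_cases hT0 : T = 0
  · have : ∀ x, g x = 0 := fun x => le_antisymm (hT0 ▸ le_iSup g x) zero_le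
    simp [this, hb]
  set c := S ^ a * T ^ b with hc
  have hc0 : c ≠ 0 := mul_ne_zero (by simp [hS0, hf1]) (by simp [hT0, hg1])
  have hct : c ≠ ⊤ := ENNReal.mul_ne_top (ENNReal.rpow_ne_top_of_nonneg ha.le hf1)
    (ENNReal.rpow_ne_top_of_nonneg hb.le hg1)
  have hci : c⁻¹ = S⁻¹ ^ a * T⁻¹ ^ b := by
    rw [hc, ENNReal.mul_inv (Or.inr (ENNReal.rpow_ne_top_of_nonneg hb.le hg1))
      (Or.inl (ENNReal.rpow_ne_top_of_nonneg ha.le hf1)), ENNReal.inv_rpow, ENNReal.inv_rpow]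
  have := pl1_norm ha hb hab (f := fun x => S⁻¹ * f x) (g := fun x => T⁻¹ * g x)
    (h := fun x => c⁻¹ * h x) (hf.const_mul _) (hg.const_mul _) (hh.const_mul _)
    (by rw [← ENNReal.mul_iSup, ENNReal.inv_mul_cancel hS0 hf1])
    (by rw [← ENNReal.mul_iSup, ENNReal.inv_mul_cancel hT0 hg1])
    (fun x y => by
      rw [ENNReal.mul_rpow_of_nonneg _ _ ha.le, ENNReal.mul_rpow_of_nonneg _ _ hb.le,
        mul_mul_mul_comm, ← hci]
      gcongr
      exact H x y)
  rw [lintegral_const_mul _ hf, lintegral_const_mul _ hg, lintegral_const_mul _ hh,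
    ENNReal.mul_rpow_of_nonneg _ _ ha.le, ENNReal.mul_rpow_of_nonneg _ _ hb.le,
        mul_mul_mul_comm, ← hci] at this
  exact (ENNReal.mul_le_mul_iff_right (ENNReal.inv_ne_zero.2 hct) (ENNReal.inv_ne_top.2 hc0)).1 this

lemma lintegral_trunc {f : ℝ → ℝ≥0∞} (hf : Measurable f) :
    ∫⁻ x, f x = ⨆ N : ℕ, ∫⁻ x, min (f x) N := by
  rw [← lintegral_iSup (fun n => hf.min measurable_const)]
  · congr 1
    ext x
    rw [← inf_iSup_eq (f := fun N : ℕ => (N : ℝ≥0∞)), ENNReal.iSup_natCast, inf_top_eq]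
  · intro m n hmn x
    exact min_le_min le_rfl (by exact_mod_cast hmn)

lemma iSup_rpow' {a : ℝ} (ha : 0 < a) (u : ℕ → ℝ≥0∞) : (⨆ n, u n) ^ a = ⨆ n, u n ^ a :=
  (ENNReal.orderIsoRpow a ha).map_iSup u

lemma pl1 {a b : ℝ} (ha : 0 < a) (hb : 0 < b) (hab : a + b = 1) {f g h : ℝ → ℝ≥0∞}
    (hf : Measurable f) (hg : Measurable g) (hh : Measurable h)
    (H : ∀ x y, f x ^ a * g y ^ b ≤ h (a * x + b * y)) :
    (∫⁻ x, f x) ^ a * (∫⁻ x, g x) ^ b ≤ ∫⁻ x, h x := by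
  have hb' : ∀ (f : ℝ → ℝ≥0∞) (N : ℕ), ⨆ x, min (f x) N ≠ ⊤ := fun f N =>
    ((iSup_le fun x => min_le_right _ _ : ⨆ x, min (f x) N ≤ (N : ℝ≥0∞)).trans_lt
      (ENNReal.natCast_lt_top N)).ne
  rw [lintegral_trunc hf, lintegral_trunc hg, iSup_rpow' ha, iSup_rpow' hb, ENNReal.iSup_mul]
  refine iSup_le fun N => ?_
  rw [ENNReal.mul_iSup]
  refine iSup_le fun M => ?_
  refine pl1_fin ha hb hab (hf.min measurable_const) (hg.min measurable_const) hh (hb' f N)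
    (hb' g M) fun x y => le_trans ?_ (H x y)
  gcongr <;> exact min_le_left _ _

lemma pl_pi {a b : ℝ} (ha : 0 < a) (hb : 0 < b) (hab : a + b = 1) (n : ℕ) :
    ∀ {f g h : (Fin n → ℝ) → ℝ≥0∞}, Measurable f → Measurable g → Measurable h →
    (∀ x y, f x ^ a * g y ^ b ≤ h (a • x + b • y)) →
    (∫⁻ x, f x) ^ a * (∫⁻ x, g x) ^ b ≤ ∫⁻ x, h x := by
  induction n with
  | zero =>
    intro f g h hf hg hh H
    simp only [lintegral_unique, volume_pi, Measure.pi_univ, Finset.univ_eq_empty,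
      Finset.prod_empty, mul_one]
    refine (H _ _).trans (le_of_eq (congrArg h (Subsingleton.elim _ _)))
  | succ n ih =>
    intro f g h hf hg hh H
    have key : ∀ f : (Fin (n+1) → ℝ) → ℝ≥0∞, Measurable f →
        ∫⁻ x, f x = ∫⁻ t : ℝ, ∫⁻ y : Fin n → ℝ, f (Fin.cons t y) := by
      intro f hf
      have hp := (volume_preserving_piFinSuccAbove (fun _ : Fin (n+1) => ℝ) 0).symm
      rw [← hp.lintegral_comp_emb (MeasurableEquiv.measurableEmbedding _) f,
        Measure.volume_eq_prod, lintegral_prod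
          (fun z => f ((MeasurableEquiv.piFinSuccAbove (fun _ : Fin (n+1) => ℝ) 0).symm z))
          (hf.comp (MeasurableEquiv.measurable _)).aemeasurable]
      simp [MeasurableEquiv.piFinSuccAbove, Fin.insertNthEquiv]
    have hc : Measurable fun p : ℝ × (Fin n → ℝ) => (Fin.cons p.1 p.2 : Fin (n+1) → ℝ) := by
      rw [measurable_pi_iff]
      intro i
      refine Fin.cases ?_ (fun j => ?_) i
      · simpa using measurable_fst
      · simp only [Fin.cons_succ]; fun_prop
    have hc' : ∀ t : ℝ, Measurable fun y : Fin n → ℝ => (Fin.cons t y : Fin (n+1) → ℝ) :=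
      fun t => hc.comp measurable_prodMk_left
    rw [key f hf, key g hg, key h hh]
    refine pl1 ha hb hab (hf.comp hc).lintegral_prod_right' (hg.comp hc).lintegral_prod_right'
      (hh.comp hc).lintegral_prod_right' fun s t => ?_
    refine ih (hf.comp (hc' s)) (hg.comp (hc' t)) (hh.comp (hc' _)) fun x y => ?_
    refine (H _ _).trans (le_of_eq (congrArg h ?_))
    ext i
    refine Fin.cases ?_ (fun j => ?_) i <;> simp

lemma bm_mul {a b : ℝ} (ha : 0 < a) (hb : 0 < b) (hab : a + b = 1) (n : ℕ)
    {A B C : Set (EuclideanSpace ℝ (Fin n))} (hA : MeasurableSet A) (hB : MeasurableSet B)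
    (hC : MeasurableSet C) (H : ∀ x ∈ A, ∀ y ∈ B, a • x + b • y ∈ C) :
    volume A ^ a * volume B ^ b ≤ volume C := by
  classical
  have hm : Measurable (WithLp.toLp 2 : (Fin n → ℝ) → EuclideanSpace ℝ (Fin n)) :=
    (PiLp.volume_preserving_toLp (Fin n)).measurable
  have key : ∀ A : Set (EuclideanSpace ℝ (Fin n)), MeasurableSet A →
      volume A = ∫⁻ x : Fin n → ℝ, A.indicator 1 (WithLp.toLp 2 x) := by
    intro A hA
    rw [(PiLp.volume_preserving_toLp (Fin n)).lintegral_comp (measurable_one.indicator hA),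
      lintegral_indicator_one hA]
  rw [key A hA, key B hB, key C hC]
  refine pl_pi ha hb hab n ((measurable_one.indicator hA).comp hm)
    ((measurable_one.indicator hB).comp hm) ((measurable_one.indicator hC).comp hm) fun x y => ?_
  by_cases hx : WithLp.toLp 2 x ∈ A
  · by_cases hy : WithLp.toLp 2 y ∈ B
    · have := H _ hx _ hy
      simp [hx, hy, this]
    · simp [hy, hb]
  · simp [hx, ha]

lemma isOpen_minkSum (n : ℕ) (r : ℝ) (A : Set (EuclideanSpace ℝ (Fin n))) :
    IsOpen (minkSum n r A) :=
  isOpen_biUnion fun _ _ => isOpen_ball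

lemma mem_minkSum {n : ℕ} {r : ℝ} {A : Set (EuclideanSpace ℝ (Fin n))}
    {y : EuclideanSpace ℝ (Fin n)} : y ∈ minkSum n r A ↔ ∃ x ∈ A, dist y x < r := by
  simp [minkSum]

lemma vol_ball {n : ℕ} (hn : 1 ≤ n) {ρ : ℝ} (hρ : 0 ≤ ρ) :
    volume (ball (0 : EuclideanSpace ℝ (Fin n)) ρ) =
      ENNReal.ofReal (ρ ^ n) * volume (ball (0 : EuclideanSpace ℝ (Fin n)) 1) := by
  have : Nonempty (Fin n) := ⟨⟨0, hn⟩⟩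
  rw [Measure.addHaar_ball _ _ hρ]
  simp

lemma bm_ball_meas {n : ℕ} (hn : 1 ≤ n) {r ρ : ℝ} (hr : 0 < r) (hρ : 0 < ρ)
    {K : Set (EuclideanSpace ℝ (Fin n))} (hK : MeasurableSet K)
    (hv : volume K = volume (ball (0 : EuclideanSpace ℝ (Fin n)) ρ)) :
    volume (ball (0 : EuclideanSpace ℝ (Fin n)) (ρ + r)) ≤ volume (minkSum n r K) := by
  have hs : 0 < ρ + r := by positivity
  set ω := volume (ball (0 : EuclideanSpace ℝ (Fin n)) 1) with hω
  have key := bm_mul (a := ρ / (ρ + r)) (b := r / (ρ + r)) (by positivity) (by positivity)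
    (by field_simp) n (A := ρ⁻¹ • K) (B := ball 0 1) (C := (ρ + r)⁻¹ • minkSum n r K)
    (hK.const_smul₀ _) measurableSet_ball ((isOpen_minkSum n r K).measurableSet.const_smul₀ _) ?_
  · have e1 : volume (ρ⁻¹ • K) = ω := by
      rw [Measure.addHaar_smul, hv, vol_ball hn hρ.le, ← mul_assoc,
        ← ENNReal.ofReal_mul (abs_nonneg _)]
      have : |ρ⁻¹ ^ Module.finrank ℝ (EuclideanSpace ℝ (Fin n))| * ρ ^ n = 1 := by
        rw [abs_of_pos (by positivity), finrank_euclideanSpace_fin, ← mul_pow,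
          inv_mul_cancel₀ hρ.ne', one_pow]
      rw [this, ENNReal.ofReal_one, one_mul]
    rw [e1, ← hω, ← ENNReal.rpow_add_of_nonneg _ _ (by positivity) (by positivity),
      show ρ / (ρ + r) + r / (ρ + r) = 1 by field_simp, ENNReal.rpow_one,
      Measure.addHaar_smul] at key
    rw [vol_ball hn hs.le, ← hω]
    refine (mul_le_mul_right key _).trans ?_
    rw [← mul_assoc, ← ENNReal.ofReal_mul (by positivity)]
    have : (ρ + r) ^ n * |(ρ + r)⁻¹ ^ Module.finrank ℝ (EuclideanSpace ℝ (Fin n))| = 1 := by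
      rw [abs_of_pos (by positivity), finrank_euclideanSpace_fin, ← mul_pow,
        mul_inv_cancel₀ hs.ne', one_pow]
    rw [this]; simp
  · rintro _ ⟨x, hx, rfl⟩ y hy
    refine ⟨x + r • y, ?_, ?_⟩
    · rw [mem_minkSum]
      refine ⟨x, hx, ?_⟩
      rw [dist_eq_norm, add_sub_cancel_left, norm_smul, Real.norm_of_nonneg hr.le]
      have : ‖y‖ < 1 := by simpa using hy
      nlinarith
    · simp only [smul_add, smul_smul]
      congr 2 <;> field_simp

lemma bm_ball {n : ℕ} (hn : 1 ≤ n) {r ρ : ℝ} (hr : 0 < r) (hρ : 0 < ρ)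
    {K : Set (EuclideanSpace ℝ (Fin n))} (hK : NullMeasurableSet K volume)
    (hv : volume K = volume (ball (0 : EuclideanSpace ℝ (Fin n)) ρ)) :
    volume (ball (0 : EuclideanSpace ℝ (Fin n)) (ρ + r)) ≤ volume (minkSum n r K) := by
  obtain ⟨L, hLK, hL, hae⟩ := hK.exists_measurable_subset_ae_eq
  refine (bm_ball_meas hn hr hρ hL (by rw [measure_congr hae, hv])).trans (measure_mono ?_)
  exact biUnion_subset_biUnion_left hLK

lemma exists_radius {n : ℕ} (hn : 1 ≤ n) {m : ℝ≥0∞} (h0 : m ≠ 0) (ht : m ≠ ⊤) :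
    ∃ ρ : ℝ, 0 < ρ ∧ m = volume (ball (0 : EuclideanSpace ℝ (Fin n)) ρ) := by
  set ω := volume (ball (0 : EuclideanSpace ℝ (Fin n)) 1) with hω
  have hω0 : ω ≠ 0 := (measure_ball_pos volume _ one_pos).ne'
  have hωt : ω ≠ ⊤ := measure_ball_lt_top.ne
  have hq0 : m / ω ≠ 0 := ENNReal.div_ne_zero.2 ⟨h0, hωt⟩
  have hqt : m / ω ≠ ⊤ := ENNReal.div_ne_top ht hω0
  have hq : 0 < (m / ω).toReal := ENNReal.toReal_pos hq0 hqt
  refine ⟨(m / ω).toReal ^ ((n : ℝ)⁻¹), by positivity, ?_⟩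
  rw [vol_ball hn (by positivity), Real.rpow_inv_natCast_pow hq.le (by omega),
    ENNReal.ofReal_toReal hqt, ENNReal.div_mul_cancel hω0 hωt]

lemma radius_le {n : ℕ} (hn : 1 ≤ n) {s t : ℝ} (ht : 0 ≤ t) (hs : 0 ≤ s)
    (h : volume (ball (0 : EuclideanSpace ℝ (Fin n)) s) ≤
      volume (ball (0 : EuclideanSpace ℝ (Fin n)) t)) : s ≤ t := by
  have hω0 : volume (ball (0 : EuclideanSpace ℝ (Fin n)) 1) ≠ 0 :=
    (measure_ball_pos volume _ one_pos).ne'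
  have hωt : volume (ball (0 : EuclideanSpace ℝ (Fin n)) 1) ≠ ⊤ := measure_ball_lt_top.ne
  rw [vol_ball hn hs, vol_ball hn ht, ENNReal.mul_le_mul_iff_left hω0 hωt,
    ENNReal.ofReal_le_ofReal_iff (by positivity)] at h
  exact (pow_le_pow_iff_left₀ hs ht (by omega)).1 h

lemma crossing {n : ℕ} {D s : Set (EuclideanSpace ℝ (Fin n))} (hs : IsPreconnected s)
    {x y : EuclideanSpace ℝ (Fin n)} (hx : x ∈ s) (hy : y ∈ s) (hxD : x ∈ D) (hyD : y ∉ D) :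
    ∃ z ∈ s, z ∈ frontier D := by
  by_contra hcon
  push Not at hcon
  have hint : ∀ z ∈ s, z ∈ closure D → z ∈ interior D := fun z hz hc => by
    by_contra hi; exact hcon z hz ⟨hc, hi⟩
  obtain ⟨z, -, hz1, hz2⟩ := hs (interior D) (closure D)ᶜ isOpen_interior
    isClosed_closure.isOpen_compl
    (fun z hz => by
      by_cases hc : z ∈ closure D
      · exact Or.inl (hint z hz hc)
      · exact Or.inr hc)
    ⟨x, hx, hint x hx (subset_closure hxD)⟩
    ⟨y, hy, fun hc => hyD (interior_subset (hint y hy hc))⟩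
  exact hz2 (subset_closure (interior_subset hz1))

lemma density_ae {n : ℕ} (hn : 1 ≤ n) {E : Set (EuclideanSpace ℝ (Fin n))}
    (hE : MeasurableSet E) : densityOnePoints n E =ᵐ[volume] E := by
  have : Nonempty (Fin n) := ⟨⟨0, hn⟩⟩
  filter_upwards [Besicovitch.ae_tendsto_measure_inter_div_of_measurableSet volume hE] with x hx
  have hb : ∀ ρ : ℝ, ball x ρ =ᵐ[volume] closedBall x ρ := fun ρ => by
    refine (ae_eq_of_subset_of_measure_ge ball_subset_closedBall ?_
      measurableSet_ball.nullMeasurableSet measure_closedBall_lt_top.ne)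
    rw [Measure.addHaar_closedBall_eq_addHaar_ball]
  have heq : (fun ρ : ℝ => volume (E ∩ closedBall x ρ) / volume (closedBall x ρ)) =
      fun ρ : ℝ => volume (E ∩ ball x ρ) / volume (ball x ρ) := by
    ext ρ
    rw [measure_congr (hb ρ), measure_congr ((ae_eq_refl E).inter (hb ρ))]
  rw [heq] at hx
  have : (x ∈ densityOnePoints n E) ↔ x ∈ E := by
    constructor
    · intro h
      by_contra hxE
      rw [indicator_of_notMem hxE] at hx
      exact zero_ne_one (tendsto_nhds_unique hx h)
    · intro h
      rw [indicator_of_mem h] at hx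
      exact hx
  exact propext this

lemma ball_subset_density {n : ℕ} {R : ℝ} :
    ball (0 : EuclideanSpace ℝ (Fin n)) R ⊆ densityOnePoints n (ball 0 R) := by
  intro x hx
  obtain ⟨ε, hε, hsub⟩ := Metric.isOpen_iff.1 isOpen_ball x hx
  refine tendsto_const_nhds.congr' ?_
  filter_upwards [Ioo_mem_nhdsGT hε] with ρ hρ
  rw [inter_eq_self_of_subset_right ((ball_subset_ball hρ.2.le).trans hsub),
    ENNReal.div_self (measure_ball_pos volume _ hρ.1).ne' measure_ball_lt_top.ne]

lemma density_subset_closedBall {n : ℕ} {R : ℝ} :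
    densityOnePoints n (ball 0 R) ⊆ closedBall (0 : EuclideanSpace ℝ (Fin n)) R := by
  intro x hx
  by_contra hxc
  obtain ⟨ε, hε, hsub⟩ := Metric.isOpen_iff.1
    (isClosed_closedBall (x := (0 : EuclideanSpace ℝ (Fin n))) (ε := R)).isOpen_compl x hxc
  have : Tendsto (fun ρ : ℝ => volume (ball (0 : EuclideanSpace ℝ (Fin n)) R ∩ ball x ρ) /
      volume (ball x ρ)) (nhdsWithin 0 (Ioi 0)) (nhds 0) := by
    refine tendsto_const_nhds.congr' ?_
    filter_upwards [Ioo_mem_nhdsGT hε] with ρ hρ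
    have : ball (0 : EuclideanSpace ℝ (Fin n)) R ∩ ball x ρ = ∅ := by
      ext z
      simp only [mem_inter_iff, mem_empty_iff_false, iff_false, not_and]
      intro h1 h2
      exact hsub (ball_subset_ball hρ.2.le h2) (ball_subset_closedBall h1)
    simp [this]
  exact zero_ne_one (tendsto_nhds_unique this hx)

lemma minkSum_ball_subset {n : ℕ} {r R : ℝ} :
    minkSum n r (frontier (densityOnePoints n (ball 0 R))) ⊆
      ball (0 : EuclideanSpace ℝ (Fin n)) (R + r) \ ball 0 (R - r) := by
  intro y hy
  obtain ⟨x, ⟨hx1, hx2⟩, hxy⟩ := mem_minkSum.1 hy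
  have h1 : dist x 0 ≤ R :=
    closure_minimal density_subset_closedBall isClosed_closedBall hx1
  have h2 : R ≤ dist x 0 := by
    by_contra h
    exact hx2 (interior_maximal ball_subset_density isOpen_ball (not_le.1 h))
  have h3 := dist_triangle y x 0
  have h4 := dist_triangle x y 0
  rw [dist_comm x y] at h4
  simp only [Set.mem_sdiff, mem_ball, not_lt]
  constructor <;> linarith

/-- Isoperimetric inequality for the Minkowski perimeter. -/
theorem minkowski_isoperimetric (n : ℕ) (hn : 1 ≤ n) (r R : ℝ) (hr : 0 < r) (hR : 0 < R)
    (E : Set (EuclideanSpace ℝ (Fin n))) (hE : MeasurableSet E)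
    (hvol : volume E = volume (ball (0 : EuclideanSpace ℝ (Fin n)) R)) :
    perR n r (ball (0 : EuclideanSpace ℝ (Fin n)) R) ≤ perR n r E := by
  unfold perR
  refine ENNReal.div_le_div_right ?_ _
  have hae := density_ae hn hE
  set D := densityOnePoints n E with hD
  have hDv : volume D = volume (ball (0 : EuclideanSpace ℝ (Fin n)) R) := by
    rw [measure_congr hae, hvol]
  have hDm : NullMeasurableSet D volume := hE.nullMeasurableSet.congr hae.symm
  set A := minkSub n r E with hA
  have hAdef : A = D \ minkSum n r (frontier D) := rfl
  have hAm : NullMeasurableSet A volume :=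
    hDm.diff (isOpen_minkSum _ _ _).measurableSet.nullMeasurableSet
  have hAD : minkSum n r A ⊆ D := by
    intro y hy
    obtain ⟨x, hx, hxy⟩ := mem_minkSum.1 hy
    by_contra hyD
    obtain ⟨z, hz, hzf⟩ := crossing (convex_ball x r).isPreconnected (mem_ball_self hr)
      (mem_ball.2 hxy) hx.1 hyD
    exact hx.2 (mem_minkSum.2 ⟨z, hzf, by rw [dist_comm]; exact hz⟩)
  have hAv : volume A ≤ volume (ball (0 : EuclideanSpace ℝ (Fin n)) (R - r)) := by
    by_cases h0 : volume A = 0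
    · rw [h0]; exact zero_le
    have ht : volume A ≠ ⊤ :=
      ((measure_mono sdiff_subset).trans_lt (hDv ▸ measure_ball_lt_top : volume D < ⊤)).ne
    obtain ⟨ρ, hρ, hρv⟩ := exists_radius hn h0 ht
    have h1 := (bm_ball hn hr hρ hAm hρv).trans (measure_mono hAD)
    rw [hDv] at h1
    have h2 := radius_le hn hR.le (by positivity) h1
    rw [hρv]
    exact measure_mono (ball_subset_ball (by linarith))
  have hcov : minkSum n r D ⊆ minkSum n r (frontier D) ∪ A := by
    intro y hy
    by_cases hyf : y ∈ minkSum n r (frontier D)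
    · exact Or.inl hyf
    by_cases hyD : y ∈ D
    · exact Or.inr ⟨hyD, hyf⟩
    obtain ⟨x, hx, hxy⟩ := mem_minkSum.1 hy
    obtain ⟨z, hz, hzf⟩ := crossing (convex_ball y r).isPreconnected
      (mem_ball.2 (by rwa [dist_comm])) (mem_ball_self hr) hx hyD
    exact Or.inl (mem_minkSum.2 ⟨z, hzf, by rw [dist_comm]; exact hz⟩)
  refine (measure_mono minkSum_ball_subset).trans ?_
  rw [measure_sdiff (ball_subset_ball (by linarith)) measurableSet_ball.nullMeasurableSet
    measure_ball_lt_top.ne, tsub_le_iff_right]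
  calc volume (ball (0 : EuclideanSpace ℝ (Fin n)) (R + r)) ≤ volume (minkSum n r D) :=
        bm_ball hn hr hR hDm hDv
    _ ≤ volume (minkSum n r (frontier D)) + volume A :=
        (measure_mono hcov).trans (measure_union_le _ _)
    _ ≤ _ := by gcongr
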